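/- Let γ=((a,b),(c,d)) and γ'=((a',b'),(c',d')) be in SL₂(ℤ) with c ≠ 0, c' ≠ 0, and ca'+dc' ≠ 0 (the lower-left entry of γγ'). Then for all x=(x₁,x₂) ∈ ℚ² and all ω=(ω₁,ω₂) ∈ ℝ² whose entries are linearly independent over ℚ, the cocycle identity 𝔷₀(γγ')(x,ω) = 𝔷₀(γ)(x,ω) + 𝔷₀(γ')(x·γ⁻ᵀ, γᵀω) holds, where x·γ⁻ᵀ = (d·x₁ − b·x₂, −c·x₁ + a·x₂) and γᵀω = (a·ω₁ + c·ω₂, b·ω₁ + d·ω₂). -/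

import Mathlib

open scoped Pointwise Classical
open MeasureTheory

/-- Periodic Bernoulli function `B̄₁`. -/
noncomputable def B1 (y : ℝ) : ℝ := if ∃ n : ℤ, (n : ℝ) = y then 0 else Int.fract y - 1 / 2

/-- Periodic Bernoulli function `B̄₂`. -/
noncomputable def B2 (y : ℝ) : ℝ := Int.fract y ^ 2 - Int.fract y + 1 / 6

/-- Dedekind–Rademacher sum `S(a,c;x)`. -/
noncomputable def DR (a c : ℤ) (x₁ x₂ : ℝ) : ℝ :=
  ∑ m ∈ Finset.range c.natAbs, B1 (x₁ + (x₂ + m) * a / c) * B1 ((x₂ + m) / c)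

/-- Indicator function of `ℤ ⊆ ℚ`. -/
def indZ (q : ℚ) : ℝ := if q.den = 1 then 1 else 0

/-- The cocycle `𝔷₀(γ)(x, ω)` for `γ` with entries `a, b, c, d` and `c ≠ 0`;
only `a` and `c` enter the formula. -/
noncomputable def Z0 (a c : ℤ) (x₁ x₂ : ℚ) (ω₁ ω₂ : ℝ) : ℝ :=
  (Int.gcd a c : ℝ) ^ 2 / (2 * c * ((a : ℝ) + c * (ω₂ / ω₁))) *
      B2 (((c : ℝ) / (Int.gcd a c : ℝ)) * (x₁ : ℝ) - ((a : ℝ) / (Int.gcd a c : ℝ)) * (x₂ : ℝ))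
    + ((a : ℝ) + c * (ω₂ / ω₁)) / (2 * c) * B2 (x₂ : ℝ)
    + Real.sign (c : ℝ) * DR (-a) c (x₁ : ℝ) (x₂ : ℝ)
    - Real.sign ((c : ℝ) * ((a : ℝ) + c * (ω₂ / ω₁))) / 4 * indZ x₁ * indZ x₂

/-- The closed triangle `T_γ` in `ℝ²` with vertices `(0,0)`, `(a−1,c)`, `(−1,0)`. -/
def Tri (a c : ℤ) : Set (ℝ × ℝ) :=
  convexHull ℝ {((0 : ℝ), (0 : ℝ)), (((a : ℝ) - 1), (c : ℝ)), ((-1 : ℝ), (0 : ℝ))}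

/-- Number of integral points in a subset of `ℝ²`. -/
noncomputable def latticeCount (S : Set (ℝ × ℝ)) : ℕ :=
  Set.ncard {p : ℤ × ℤ | ((p.1 : ℝ), (p.2 : ℝ)) ∈ S}

/-- The `0`th Ehrhart coefficient `G₀(ℓ⁻¹ T_σ, m)` of the dilated triangle `ℓ⁻¹ T_σ`,
obtained by subtracting the second and first Ehrhart coefficient terms from the
lattice point count of `(m/ℓ)·T_σ`. -/
noncomputable def G0 (aσ cσ : ℤ) (ℓσ ℓ : ℕ) (m : ℕ) : ℝ :=
  (latticeCount (((m : ℝ) / (ℓ : ℝ)) • Tri aσ cσ) : ℝ)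
    - (cσ : ℝ) / (2 * (ℓ : ℝ) ^ 2) * (m : ℝ) ^ 2
    - ((ℓσ : ℝ) + 2) / (2 * (ℓ : ℝ)) * (m : ℝ)



/-- Indicator of the integers on the reals. -/
noncomputable def dl (y : ℝ) : ℝ := if Int.fract y = 0 then 1 else 0

lemma exists_int_iff_fract (y : ℝ) : (∃ n : ℤ, (n : ℝ) = y) ↔ Int.fract y = 0 := by
  rw [Int.fract_eq_zero_iff]
  exact Iff.rfl

lemma B1_eq (y : ℝ) : B1 y = Int.fract y - 1 / 2 + dl y / 2 := by
  unfold B1 dl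
  rw [exists_int_iff_fract]
  split_ifs with h
  · rw [h]; norm_num
  · ring

lemma dl_add_int (y : ℝ) (n : ℤ) : dl (y + n) = dl y := by simp [dl]
lemma B1_add_int (y : ℝ) (n : ℤ) : B1 (y + n) = B1 y := by simp [B1_eq, dl_add_int]
lemma B2_add_int (y : ℝ) (n : ℤ) : B2 (y + n) = B2 y := by simp [B2]

lemma fract_neg_eq (y : ℝ) : Int.fract (-y) = if Int.fract y = 0 then 0 else 1 - Int.fract y := by
  split_ifs with h
  · rw [Int.fract_neg_eq_zero]; exact h
  · exact Int.fract_neg h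

lemma dl_neg (y : ℝ) : dl (-y) = dl y := by simp [dl, Int.fract_neg_eq_zero]
lemma B1_neg (y : ℝ) : B1 (-y) = -B1 y := by
  rw [B1_eq, B1_eq, dl_neg, fract_neg_eq, dl]
  split_ifs with h
  · rw [h]; norm_num
  · ring
lemma B2_neg (y : ℝ) : B2 (-y) = B2 y := by
  rw [B2, B2, fract_neg_eq]
  split_ifs with h
  · rw [h]
  · ring

/-- The pointwise identity. -/
lemma B1_three (X Y Z : ℝ) (h : X + Y + Z = 0) :
    B1 X * B1 Y + B1 Y * B1 Z + B1 X * B1 Z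
      = -(1 / 2) * (B2 X + B2 Y + B2 Z) + 1 / 4 * (dl X * dl Y) := by
  simp only [B1_eq, B2, dl]
  have hk : Int.fract X + Int.fract Y + Int.fract Z = ((-⌊X⌋ - ⌊Y⌋ - ⌊Z⌋ : ℤ) : ℝ) := by
    push_cast
    have := Int.self_sub_floor X
    have := Int.self_sub_floor Y
    have := Int.self_sub_floor Z
    linarith
  have x0 := Int.fract_nonneg X
  have y0 := Int.fract_nonneg Y
  have z0 := Int.fract_nonneg Z
  have x1 := Int.fract_lt_one X
  have y1 := Int.fract_lt_one Y
  have z1 := Int.fract_lt_one Z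
  generalize Int.fract X = x at *
  generalize Int.fract Y = y at *
  generalize Int.fract Z = z at *
  generalize (-⌊X⌋ - ⌊Y⌋ - ⌊Z⌋ : ℤ) = k at *
  have k0 : (0 : ℤ) ≤ k := by
    have : ((0 : ℤ) : ℝ) ≤ k := by push_cast; linarith
    exact_mod_cast this
  have k3 : k < 3 := by
    have : (k : ℝ) < ((3 : ℤ) : ℝ) := by push_cast; linarith
    exact_mod_cast this
  have hz : z = k - x - y := by linarith
  by_cases hx : x = 0 <;> by_cases hy : y = 0 <;> by_cases hz0 : z = 0 <;>
    simp only [hx, hy, hz0, if_true, if_false] <;> interval_cases k <;> push_cast at hz hk <;>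
    first
      | (exfalso; simp only [hx, hy, hz0] at *; linarith)
      | (exfalso; apply hx; linarith)
      | (exfalso; apply hy; linarith)
      | (exfalso; apply hz0; linarith)
      | (rw [hz]; simp only [hx, hy]; ring1)
      | (rw [hz]; ring1)
      | (have : x = 1 - y := by linarith
         rw [this]; ring1)
      | norm_num

/-- Periodic function with a distribution relation. -/
structure IsDist (f : ℝ → ℝ) (σ : ℤ → ℝ) : Prop where
  per : ∀ (y : ℝ) (n : ℤ), f (y + n) = f y
  dist : ∀ (A : ℤ), A ≠ 0 → ∀ z : ℝ, ∑ k ∈ Finset.range A.natAbs, f ((z + k) / A) = σ A * f z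
  sym : ∀ (A : ℤ) (z : ℝ), σ (-A) * f (-z) = σ A * f z

lemma dist_of_pos (f : ℝ → ℝ) (s : ℝ) (n : ℕ) (hn : 0 < n)
    (per : ∀ (y : ℝ) (n : ℤ), f (y + n) = f y)
    (h : ∀ z : ℝ, 0 ≤ z → z < 1 → ∑ k ∈ Finset.range n, f ((z + k) / n) = s * f z) (z : ℝ) :
    ∑ k ∈ Finset.range n, f ((z + k) / n) = s * f z := by
  have hn' : (n : ℝ) ≠ 0 := by positivity
  have step : ∀ z : ℝ, ∑ k ∈ Finset.range n, f ((z + 1 + k) / n)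
      = ∑ k ∈ Finset.range n, f ((z + k) / n) := by
    intro z
    have h1 := Finset.sum_range_succ (fun k : ℕ => f ((z + k) / n)) n
    rw [Finset.sum_range_succ'] at h1
    have h2 : f ((z + (n : ℕ)) / n) = f ((z + (0 : ℕ)) / n) := by
      have := per (z / n) 1
      rw [← show (z + (n : ℕ)) / n = z / n + (1 : ℤ) by push_cast; field_simp] at this
      rw [this]; simp
    have h3 : ∀ k : ℕ, f ((z + 1 + k) / n) = f ((z + ((k + 1 : ℕ) : ℝ)) / n) := by
      intro k; congr 2; push_cast; ring
    simp only [h3]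
    linarith
  have stepn : ∀ (j : ℕ) (z : ℝ), ∑ k ∈ Finset.range n, f ((z + j + k) / n)
      = ∑ k ∈ Finset.range n, f ((z + k) / n) := by
    intro j
    induction j with
    | zero => intro z; simp
    | succ j ih =>
      intro z
      rw [← ih z, ← step (z + j)]
      push_cast
      simp only [add_assoc]
  have stepz : ∀ (j : ℤ) (z : ℝ), ∑ k ∈ Finset.range n, f ((z + j + k) / n)
      = ∑ k ∈ Finset.range n, f ((z + k) / n) := by
    intro j z
    obtain ⟨m, rfl | rfl⟩ := j.eq_nat_or_neg
    · exact_mod_cast stepn m z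
    · rw [← stepn m]
      push_cast
      simp
  have e : z = Int.fract z + (⌊z⌋ : ℤ) := (Int.fract_add_floor z).symm
  have hp := per (Int.fract z) ⌊z⌋
  have hs := stepz ⌊z⌋ (Int.fract z)
  rw [← e] at hp hs
  rw [hs, hp]
  exact h _ (Int.fract_nonneg z) (Int.fract_lt_one z)

lemma IsDist.mk' (f : ℝ → ℝ) (σ : ℤ → ℝ)
    (per : ∀ (y : ℝ) (n : ℤ), f (y + n) = f y)
    (sym : ∀ (A : ℤ) (z : ℝ), σ (-A) * f (-z) = σ A * f z)
    (h : ∀ (n : ℕ), 0 < n → ∀ z : ℝ, 0 ≤ z → z < 1 →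
      ∑ k ∈ Finset.range n, f ((z + k) / n) = σ n * f z)
    (hodd : ∃ e : ℝ, ∀ z, f (-z) = e * f z) : IsDist f σ := by
  refine ⟨per, ?_, sym⟩
  intro A hA z
  have hpos : 0 < A.natAbs := Int.natAbs_pos.mpr hA
  have key := dist_of_pos f _ A.natAbs hpos per (h _ hpos) z
  rcases lt_or_gt_of_ne hA with hneg | hp
  · have h1 : ((A.natAbs : ℤ)) = -A := by omega
    have h2 : ((A.natAbs : ℕ) : ℝ) = -(A : ℝ) := by
      have := congrArg (Int.cast (R := ℝ)) h1
      push_cast at this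
      rw [Nat.cast_natAbs]; push_cast; exact this
    obtain ⟨e, he⟩ := hodd
    rw [h1, h2] at key
    have h4 : ∀ k : ℕ, f ((z + k) / A) = e * f ((z + k) / -A) := by
      intro k
      rw [← he]; congr 1; rw [div_neg, neg_neg]
    simp only [h4]
    rw [← Finset.mul_sum, key, ← sym A z, he]; ring
  · have h1 : ((A.natAbs : ℤ)) = A := by omega
    have h2 : ((A.natAbs : ℕ) : ℝ) = (A : ℝ) := by
      have := congrArg (Int.cast (R := ℝ)) h1
      push_cast at this
      rw [Nat.cast_natAbs]; push_cast; exact this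
    rw [h1, h2] at key
    exact key

lemma fract_div_of (n : ℕ) (z : ℝ) (h0 : 0 ≤ z) (h1 : z < 1) (k : ℕ) (hk : k < n) :
    Int.fract ((z + k) / n) = (z + k) / n := by
  have hn : (0 : ℝ) < n := by exact_mod_cast (by omega : 0 < n)
  have : (k : ℝ) + 1 ≤ n := by exact_mod_cast hk
  rw [Int.fract_eq_self]
  constructor
  · positivity
  · rw [div_lt_one hn]; linarith

lemma dl_dist_pos (n : ℕ) (hn : 0 < n) (z : ℝ) (h0 : 0 ≤ z) (h1 : z < 1) :
    ∑ k ∈ Finset.range n, dl ((z + k) / n) = dl z := by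
  have hn' : (0 : ℝ) < n := by exact_mod_cast hn
  rw [Finset.sum_eq_single 0]
  · have := fract_div_of n z h0 h1 0 hn
    simp only [dl, this, Int.fract_eq_self.mpr ⟨h0, h1⟩]
    simp [hn'.ne']
  · intro k hk hk0
    have := fract_div_of n z h0 h1 k (Finset.mem_range.mp hk)
    simp only [dl, this]
    have hk1 : (0 : ℝ) < k := by exact_mod_cast Nat.pos_of_ne_zero hk0
    rw [if_neg]
    positivity
  · intro h; simp at h; omega

lemma fract_dist_pos (n : ℕ) (hn : 0 < n) (z : ℝ) (h0 : 0 ≤ z) (h1 : z < 1) :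
    ∑ k ∈ Finset.range n, Int.fract ((z + k) / n) = z + (n - 1) / 2 := by
  have hn' : (n : ℝ) ≠ 0 := by positivity
  rw [Finset.sum_congr rfl (fun k hk => fract_div_of n z h0 h1 k (Finset.mem_range.mp hk))]
  have : ∀ m : ℕ, ∑ k ∈ Finset.range m, (z + k) / (n : ℝ) = (m * z + m * (m - 1) / 2) / n := by
    intro m
    induction m with
    | zero => simp
    | succ m ih => rw [Finset.sum_range_succ, ih]; push_cast; ring
  rw [this]; field_simp

lemma B2_dist_pos (n : ℕ) (hn : 0 < n) (z : ℝ) (h0 : 0 ≤ z) (h1 : z < 1) :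
    ∑ k ∈ Finset.range n, B2 ((z + k) / n) = 1 / n * B2 z := by
  have hn' : (n : ℝ) ≠ 0 := by positivity
  unfold B2
  rw [Finset.sum_congr rfl (fun k hk => by
    rw [fract_div_of n z h0 h1 k (Finset.mem_range.mp hk)])]
  rw [Int.fract_eq_self.mpr ⟨h0, h1⟩]
  have : ∀ m : ℕ, ∑ k ∈ Finset.range m, (((z + k) / (n : ℝ)) ^ 2 - (z + k) / n + 1 / 6)
    = (m * z ^ 2 + z * (m * (m - 1)) + m * (m - 1) * (2 * m - 1) / 6) / n ^ 2
      - (m * z + m * (m - 1) / 2) / n + m / 6 := by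
    intro m
    induction m with
    | zero => simp
    | succ m ih => rw [Finset.sum_range_succ, ih]; push_cast; field_simp; ring
  rw [this]; field_simp; ring

lemma isDist_dl : IsDist dl (fun _ => 1) := by
  apply IsDist.mk' _ _ dl_add_int
  · intro A z; rw [dl_neg]
  · intro n hn z h0 h1; rw [dl_dist_pos n hn z h0 h1, one_mul]
  · exact ⟨1, fun z => by rw [dl_neg, one_mul]⟩

lemma isDist_B2 : IsDist B2 (fun A => 1 / |(A : ℝ)|) := by
  apply IsDist.mk' _ _ B2_add_int
  · intro A z; rw [B2_neg]; simp
  · intro n hn z h0 h1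
    rw [B2_dist_pos n hn z h0 h1]; simp
  · exact ⟨1, fun z => by rw [B2_neg, one_mul]⟩

lemma isDist_B1 : IsDist B1 (fun A => Real.sign A) := by
  apply IsDist.mk' _ _ B1_add_int
  · intro A z; rw [B1_neg]; push_cast; rw [Real.sign_neg]; ring
  · intro n hn z h0 h1
    have hn' : (0 : ℝ) < n := by exact_mod_cast hn
    simp only [B1_eq]
    simp only [Finset.sum_add_distrib, Finset.sum_sub_distrib, ← Finset.sum_div]
    rw [fract_dist_pos n hn z h0 h1, dl_dist_pos n hn z h0 h1, Int.fract_eq_self.mpr ⟨h0, h1⟩]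
    push_cast
    rw [Real.sign_of_pos hn']
    simp
    ring
  · exact ⟨-1, fun z => by rw [B1_neg]; ring⟩

lemma natAbs_mul_cast (A : ℤ) : ∃ e : ℤ, (e = 1 ∨ e = -1) ∧ ((A.natAbs : ℕ) : ℝ) = e * (A : ℝ) := by
  rw [Nat.cast_natAbs]
  rcases le_or_gt 0 A with h | h
  · exact ⟨1, Or.inl rfl, by rw [abs_of_nonneg h]; simp⟩
  · exact ⟨-1, Or.inr rfl, by rw [abs_of_neg h]; simp⟩

lemma IsDist.sym' {f : ℝ → ℝ} {σ : ℤ → ℝ} (hf : IsDist f σ) (e : ℤ) (he : e = 1 ∨ e = -1)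
    (A : ℤ) (z : ℝ) : σ (e * A) * f (e * z) = σ A * f z := by
  rcases he with rfl | rfl
  · simp
  · have := hf.sym A z
    simpa using this

lemma IsDist.dist_mul {f : ℝ → ℝ} {σ : ℤ → ℝ} (hf : IsDist f σ) (A : ℤ) (hA : A ≠ 0) (K : ℕ)
    (z : ℝ) : ∑ k ∈ Finset.range (A.natAbs * K), f ((z + k) / A) = K * (σ A * f z) := by
  induction K with
  | zero => simp
  | succ K ih =>
    rw [Nat.mul_succ, Finset.sum_range_add, ih]
    have hA' : (A : ℝ) ≠ 0 := by exact_mod_cast hA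
    have : ∀ k : ℕ, f ((z + ((A.natAbs * K + k : ℕ) : ℝ)) / A) = f ((z + k) / A) := by
      intro k
      obtain ⟨e, -, h⟩ := natAbs_mul_cast A
      rw [← hf.per ((z + k) / A) (e * K)]
      congr 1
      rw [Nat.cast_add, Nat.cast_mul, h]
      push_cast
      field_simp
      ring
    simp only [this]
    rw [hf.dist A hA]
    push_cast; ring

lemma sum_range_mul' (g : ℕ → ℝ) (q K : ℕ) : ∑ m ∈ Finset.range (q * K), g m
    = ∑ j ∈ Finset.range q, ∑ k ∈ Finset.range K, g (j + q * k) := by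
  induction K with
  | zero => simp
  | succ K ih =>
    rw [Nat.mul_succ, Finset.sum_range_add, ih]
    simp only [Finset.sum_range_succ, Finset.sum_add_distrib]
    simp only [add_comm]

lemma box_lemma {f g : ℝ → ℝ} {σ ρ : ℤ → ℝ} (hf : IsDist f σ) (hg : IsDist g ρ)
    (p q A B : ℤ) (hq : q ≠ 0) (hA : A ≠ 0) (hB : B ≠ 0) (N K1 K2 : ℕ)
    (h1 : N = A.natAbs * K1) (h2 : N = q.natAbs * (B.natAbs * K2)) (x₁ x₂ : ℝ) :
    ∑ n ∈ Finset.range N, ∑ m ∈ Finset.range N,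
        f (((x₁ + n) - (x₂ + m) * p / q) / A) * g ((x₂ + m) / (q * B))
      = K1 * K2 * σ A * ρ B *
        ∑ j ∈ Finset.range q.natAbs, f (x₁ - (x₂ + j) * p / q) * g ((x₂ + j) / q) := by
  have hq' : (q : ℝ) ≠ 0 := by exact_mod_cast hq
  have hB' : (B : ℝ) ≠ 0 := by exact_mod_cast hB
  rw [Finset.sum_comm]
  have e1 : ∀ m : ℕ, ∑ n ∈ Finset.range N,
      f (((x₁ + n) - (x₂ + m) * p / q) / A) * g ((x₂ + m) / (q * B))
      = K1 * σ A * (f (x₁ - (x₂ + m) * p / q) * g ((x₂ + m) / (q * B))) := by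
    intro m
    rw [← Finset.sum_mul, h1]
    have := hf.dist_mul A hA K1 (x₁ - (x₂ + m) * p / q)
    rw [show (∑ n ∈ Finset.range (A.natAbs * K1), f (((x₁ + n) - (x₂ + m) * p / q) / A))
      = K1 * (σ A * f (x₁ - (x₂ + m) * p / q)) by
        rw [← this]
        refine Finset.sum_congr rfl fun n _ => ?_
        congr 2; ring]
    ring
  simp only [e1]
  rw [← Finset.mul_sum, h2, sum_range_mul']
  have e2 : ∀ j : ℕ, ∑ k ∈ Finset.range (B.natAbs * K2),
      f (x₁ - (x₂ + ((j + q.natAbs * k : ℕ) : ℝ)) * p / q)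
        * g ((x₂ + ((j + q.natAbs * k : ℕ) : ℝ)) / (q * B))
      = K2 * ρ B * (f (x₁ - (x₂ + j) * p / q) * g ((x₂ + j) / q)) := by
    intro j
    obtain ⟨e, he, hqe⟩ := natAbs_mul_cast q
    have hee : (e : ℝ) * e = 1 := by rcases he with rfl | rfl <;> norm_num
    have he0 : (e : ℝ) ≠ 0 := by rcases he with rfl | rfl <;> norm_num
    have heZ : e ≠ 0 := by rcases he with rfl | rfl <;> norm_num
    have f1 : ∀ k : ℕ, f (x₁ - (x₂ + ((j + q.natAbs * k : ℕ) : ℝ)) * p / q)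
        = f (x₁ - (x₂ + j) * p / q) := by
      intro k
      rw [← hf.per (x₁ - (x₂ + ((j + q.natAbs * k : ℕ) : ℝ)) * p / q) (e * k * p)]
      congr 1
      rw [Nat.cast_add, Nat.cast_mul, hqe]
      push_cast
      field_simp
      ring
    simp only [f1]
    rw [← Finset.mul_sum]
    have g1 : ∀ k : ℕ, g ((x₂ + ((j + q.natAbs * k : ℕ) : ℝ)) / (q * B))
        = g ((e * ((x₂ + j) / q) + k) / ((e * B : ℤ) : ℝ)) := by
      intro k
      congr 1
      rw [Nat.cast_add, Nat.cast_mul, hqe]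
      push_cast
      field_simp
      linear_combination (k : ℝ) * q * hee
    simp only [g1]
    have hab : B.natAbs = (e * B).natAbs := by
      rcases he with rfl | rfl <;> simp
    rw [hab, hg.dist_mul (e * B) (mul_ne_zero heZ hB), hg.sym' e he]
    ring
  simp only [e2]
  rw [← Finset.mul_sum]
  ring

lemma box_B2 (D : ℤ) (hD : D ≠ 0) (N K : ℕ) (h : N = D.natAbs * K) (x₂ : ℝ) :
    ∑ _n ∈ Finset.range N, ∑ m ∈ Finset.range N, B2 ((x₂ + m) / D)
      = N * (K * (1 / |(D : ℝ)| * B2 x₂)) := by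
  rw [Finset.sum_const, Finset.card_range, nsmul_eq_mul]
  congr 1
  conv_lhs => rw [h]
  exact isDist_B2.dist_mul D hD K x₂

lemma sum_dl_dl (p q : ℤ) (hq : q ≠ 0) (x₁ x₂ : ℝ) :
    ∑ j ∈ Finset.range q.natAbs, dl (x₁ - (x₂ + j) * p / q) * dl ((x₂ + j) / q)
      = dl x₁ * dl x₂ := by
  have hq' : (q : ℝ) ≠ 0 := by exact_mod_cast hq
  have e : ∀ j : ℕ, dl (x₁ - (x₂ + j) * p / q) * dl ((x₂ + j) / q)
      = dl x₁ * dl ((x₂ + j) / q) := by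
    intro j
    by_cases h : Int.fract ((x₂ + j) / q) = 0
    · obtain ⟨k, hk⟩ := (exists_int_iff_fract _).mpr h
      rw [← dl_add_int (x₁ - (x₂ + j) * p / q) (k * p)]
      congr 2
      push_cast
      rw [hk]; ring
    · have : dl ((x₂ + j) / q) = 0 := if_neg h
      rw [this]; simp
  simp only [e]
  rw [← Finset.mul_sum, isDist_dl.dist q hq, one_mul]

/-- Invariance of box sums of periodic functions under `SL₂(ℤ)`. -/
lemma box_SL2 (N : ℕ) [NeZero N] (F : ℤ → ℤ → ℝ)
    (hF : ∀ n m i j : ℤ, F (n + N * i) (m + N * j) = F n m)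
    (a b c d : ℤ) (h : a * d - b * c = 1) :
    ∑ n ∈ Finset.range N, ∑ m ∈ Finset.range N, F n m
      = ∑ n ∈ Finset.range N, ∑ m ∈ Finset.range N, F (a * n + b * m) (c * n + d * m) := by
  have toZ : ∀ G : ℤ → ℤ → ℝ, ∑ n ∈ Finset.range N, ∑ m ∈ Finset.range N, G n m
      = ∑ z : ZMod N × ZMod N, G (z.1.val : ℤ) (z.2.val : ℤ) := by
    intro G
    have one : ∀ g : ℕ → ℝ, ∑ n ∈ Finset.range N, g n = ∑ z : ZMod N, g z.val := by
      intro g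
      symm
      refine Finset.sum_bij (fun z _ => z.val) ?_ ?_ ?_ ?_
      · intro z _; exact Finset.mem_range.mpr (ZMod.val_lt z)
      · intro z _ w _ hzw; exact ZMod.val_injective N hzw
      · intro n hn
        exact ⟨(n : ZMod N), Finset.mem_univ _, ZMod.val_cast_of_lt (Finset.mem_range.mp hn)⟩
      · intros; rfl
    rw [Fintype.sum_prod_type, one (fun n => ∑ m ∈ Finset.range N, G n m)]
    refine Finset.sum_congr rfl fun z _ => ?_
    exact one (fun m => G (z.val : ℕ) m)
  have hcongr : ∀ n m n' m' : ℤ, (n : ZMod N) = n' → (m : ZMod N) = m' → F n m = F n' m' := by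
    intro n m n' m' h1 h2
    rw [ZMod.intCast_eq_intCast_iff_dvd_sub] at h1 h2
    obtain ⟨i, hi⟩ := h1
    obtain ⟨j, hj⟩ := h2
    rw [← hF n m i j, ← hi, ← hj]
    congr 1 <;> ring
  have hz : (a : ZMod N) * d - b * c = 1 := by exact_mod_cast congrArg (Int.cast (R := ZMod N)) h
  let E : ZMod N × ZMod N ≃ ZMod N × ZMod N :=
    { toFun := fun z => (a * z.1 + b * z.2, c * z.1 + d * z.2)
      invFun := fun z => (d * z.1 - b * z.2, -c * z.1 + a * z.2)
      left_inv := by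
        rintro ⟨z, w⟩
        ext
        · simp only; linear_combination z * hz
        · simp only; linear_combination w * hz
      right_inv := by
        rintro ⟨z, w⟩
        ext
        · simp only; linear_combination z * hz
        · simp only; linear_combination w * hz }
  rw [toZ, toZ (fun n m => F (a * n + b * m) (c * n + d * m))]
  symm
  refine Fintype.sum_equiv E _ _ ?_
  intro z
  apply hcongr <;> simp [E]

/-- The affine form `det((p,q), x + (n,m)) / D`. -/
noncomputable def L (x₁ x₂ : ℝ) (p q D : ℤ) (n m : ℤ) : ℝ :=
  (p * (x₂ + m) - q * (x₁ + n)) / D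

lemma L_per (f : ℝ → ℝ) (hf : ∀ (y : ℝ) (n : ℤ), f (y + n) = f y) (x₁ x₂ : ℝ) (p q D : ℤ)
    (hD : D ≠ 0) (N : ℕ) (hN : D ∣ (N : ℤ)) (n m i j : ℤ) :
    f (L x₁ x₂ p q D (n + N * i) (m + N * j)) = f (L x₁ x₂ p q D n m) := by
  have hD' : (D : ℝ) ≠ 0 := by exact_mod_cast hD
  obtain ⟨e, he⟩ := hN
  have he' : (N : ℝ) = D * e := by exact_mod_cast congrArg (Int.cast (R := ℝ)) he
  rw [← hf (L x₁ x₂ p q D n m) (e * (p * j - q * i))]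
  congr 1
  unfold L
  push_cast
  rw [he']
  field_simp
  ring

lemma L_trans (x₁ x₂ : ℝ) (p q D a b c d : ℤ) (h : a * d - b * c = 1) (n m : ℤ) :
    L x₁ x₂ p q D (a * n + b * m) (c * n + d * m)
      = L (d * x₁ - b * x₂) (-(c * x₁) + a * x₂) (d * p - b * q) (-c * p + a * q) D n m := by
  have h1 : (a : ℝ) * d - b * c = 1 := by exact_mod_cast congrArg (Int.cast (R := ℝ)) h
  unfold L
  congr 1
  push_cast
  linear_combination (-(p : ℝ) * x₂ + q * x₁) * h1

lemma sign_cases (A : ℤ) (hA : A ≠ 0) :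
    (Real.sign (A : ℝ) = 1 ∧ |(A : ℝ)| = A) ∨ (Real.sign (A : ℝ) = -1 ∧ |(A : ℝ)| = -A) := by
  rcases lt_or_gt_of_ne hA with h | h
  · have : (A : ℝ) < 0 := by exact_mod_cast h
    exact Or.inr ⟨Real.sign_of_neg this, abs_of_neg this⟩
  · have : (0 : ℝ) < A := by exact_mod_cast h
    exact Or.inl ⟨Real.sign_of_pos this, abs_of_pos this⟩

lemma sum_B1_B1 (p q A B : ℤ) (hq : q ≠ 0) (hA : A ≠ 0) (hB : B ≠ 0) (N : ℕ)
    (hN : N = A.natAbs * (q.natAbs * B.natAbs)) (x₁ x₂ : ℝ) :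
    ∑ n ∈ Finset.range N, ∑ m ∈ Finset.range N,
        B1 (L x₁ x₂ 1 0 (q * B) n m) * B1 (L x₁ x₂ p q (A * q) n m)
      = -(N * Real.sign A * Real.sign B * DR (-p) q x₁ x₂) := by
  have hq' : (q : ℝ) ≠ 0 := by exact_mod_cast hq
  have hA' : (A : ℝ) ≠ 0 := by exact_mod_cast hA
  have key := box_lemma isDist_B1 isDist_B1 p q A B hq hA hB N (q.natAbs * B.natAbs) A.natAbs
    hN (by rw [hN]; ring) x₁ x₂
  have e : ∀ n m : ℕ, B1 (L x₁ x₂ 1 0 (q * B) n m) * B1 (L x₁ x₂ p q (A * q) n m)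
      = -(B1 (((x₁ + n) - (x₂ + m) * p / q) / A) * B1 ((x₂ + m) / (q * B))) := by
    intro n m
    have e1 : L x₁ x₂ 1 0 (q * B) n m = (x₂ + m) / (q * B) := by
      unfold L; push_cast; ring
    have e2 : L x₁ x₂ p q (A * q) n m = -(((x₁ + n) - (x₂ + m) * p / q) / A) := by
      unfold L; push_cast; field_simp; ring
    rw [e1, e2, B1_neg]; ring
  simp only [e, Finset.sum_neg_distrib]
  rw [key, DR, hN]
  have : ∀ j : ℕ, x₁ + (x₂ + j) * ((-p : ℤ) : ℝ) / q = x₁ - (x₂ + j) * p / q := by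
    intro j; push_cast; ring
  simp only [this]
  push_cast
  ring

lemma sum_dl_L (p q A B : ℤ) (hq : q ≠ 0) (hA : A ≠ 0) (hB : B ≠ 0) (N : ℕ)
    (hN : N = A.natAbs * (q.natAbs * B.natAbs)) (x₁ x₂ : ℝ) :
    ∑ n ∈ Finset.range N, ∑ m ∈ Finset.range N,
        dl (L x₁ x₂ 1 0 (q * B) n m) * dl (L x₁ x₂ p q (A * q) n m)
      = N * (dl x₁ * dl x₂) := by
  have hq' : (q : ℝ) ≠ 0 := by exact_mod_cast hq
  have hA' : (A : ℝ) ≠ 0 := by exact_mod_cast hA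
  have key := box_lemma isDist_dl isDist_dl p q A B hq hA hB N (q.natAbs * B.natAbs) A.natAbs
    hN (by rw [hN]; ring) x₁ x₂
  have e : ∀ n m : ℕ, dl (L x₁ x₂ 1 0 (q * B) n m) * dl (L x₁ x₂ p q (A * q) n m)
      = (dl (((x₁ + n) - (x₂ + m) * p / q) / A) * dl ((x₂ + m) / (q * B))) := by
    intro n m
    have e1 : L x₁ x₂ 1 0 (q * B) n m = (x₂ + m) / (q * B) := by
      unfold L; push_cast; ring
    have e2 : L x₁ x₂ p q (A * q) n m = -(((x₁ + n) - (x₂ + m) * p / q) / A) := by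
      unfold L; push_cast; field_simp; ring
    rw [e1, e2, dl_neg]; ring
  simp only [e]
  rw [key, sum_dl_dl p q hq, hN]
  push_cast
  ring

lemma sum_B2_L (D : ℤ) (hD : D ≠ 0) (N K : ℕ) (hN : N = D.natAbs * K) (x₁ x₂ : ℝ) :
    ∑ n ∈ Finset.range N, ∑ m ∈ Finset.range N, B2 (L x₁ x₂ 1 0 D n m)
      = N * (K * (1 / |(D : ℝ)| * B2 x₂)) := by
  rw [← box_B2 D hD N K hN x₂]
  refine Finset.sum_congr rfl fun n _ => Finset.sum_congr rfl fun m _ => ?_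
  congr 1
  unfold L; push_cast; ring

/-- The Rademacher three term relation. -/
lemma core (a b c d a' b' c' d' : ℤ)
    (h : a * d - b * c = 1) (h' : a' * d' - b' * c' = 1)
    (A B C : ℤ) (hA : A ≠ 0) (hB : B ≠ 0) (hC : C ≠ 0)
    (eA : c' = A) (eB : c * a' + d * c' = -B) (eC : c = C) (x₁ x₂ : ℝ) :
    Real.sign C * DR (-a) C x₁ x₂
      + Real.sign A * DR (-a') A (d * x₁ - b * x₂) (-(c * x₁) + a * x₂)
      + Real.sign B * DR (-(a * a' + b * c')) (-B) x₁ x₂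
    = 1 / 2 * (A / (B * C) * B2 x₂ + B / (A * C) * B2 (-(c * x₁) + a * x₂)
        + C / (A * B) * B2 (B * x₁ + (a * a' + b * c' : ℤ) * x₂))
      - 1 / 4 * (Real.sign A * Real.sign B * Real.sign C) * (dl x₁ * dl x₂) := by
  have hA' : (A : ℝ) ≠ 0 := by exact_mod_cast hA
  have hB' : (B : ℝ) ≠ 0 := by exact_mod_cast hB
  have hC' : (C : ℝ) ≠ 0 := by exact_mod_cast hC
  obtain ⟨N, hN⟩ : ∃ N : ℕ, N = A.natAbs * (B.natAbs * C.natAbs) := ⟨_, rfl⟩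
  have hN0 : N ≠ 0 := by
    rw [hN]; simp [hA, hB, hC]
  have : NeZero N := ⟨hN0⟩
  have hNR : (N : ℝ) ≠ 0 := by exact_mod_cast hN0
  have dvdN : ∀ D E : ℤ, N = D.natAbs * E.natAbs → D ∣ (N : ℤ) := by
    intro D E hDE
    rw [hDE]; push_cast
    exact Dvd.dvd.mul_right ((dvd_abs D D).mpr dvd_rfl) _
  have dAC : A * C ∣ (N : ℤ) := dvdN _ B (by rw [hN, Int.natAbs_mul]; ring)
  have dAB : A * B ∣ (N : ℤ) := dvdN _ C (by rw [hN, Int.natAbs_mul]; ring)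
  have hAC := mul_ne_zero hA hC
  have hAB := mul_ne_zero hA hB
  have hCB := mul_ne_zero hC hB
  obtain ⟨p, hp⟩ : ∃ p : ℤ, p = a * a' + b * c' := ⟨_, rfl⟩
  rw [← hp]
  -- the pointwise identity
  have pt : ∀ n m : ℕ,
      B1 (L x₁ x₂ 1 0 (C * B) n m) * B1 (L x₁ x₂ a C (A * C) n m)
      + B1 (L x₁ x₂ a C (A * C) n m) * B1 (L x₁ x₂ p (-B) (A * B) n m)
      + B1 (L x₁ x₂ 1 0 (C * B) n m) * B1 (L x₁ x₂ p (-B) (A * B) n m)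
      = -(1 / 2) * (B2 (L x₁ x₂ 1 0 (C * B) n m) + B2 (L x₁ x₂ a C (A * C) n m)
          + B2 (L x₁ x₂ p (-B) (A * B) n m))
        + 1 / 4 * (dl (L x₁ x₂ 1 0 (C * B) n m) * dl (L x₁ x₂ a C (A * C) n m)) := by
    intro n m
    apply B1_three
    have hrel : A + B * a + C * p = 0 := by
      rw [hp, ← eC, ← eA]
      have : B = -(c * a' + d * c') := by linarith
      rw [this]; linear_combination (-c') * h
    have hrel' : (A : ℝ) + B * a + C * p = 0 := by exact_mod_cast hrel
    unfold L
    push_cast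
    field_simp
    linear_combination (x₂ + m) * hrel'
  have S := Finset.sum_congr (rfl : Finset.range N = Finset.range N) fun n _ =>
    Finset.sum_congr (rfl : Finset.range N = Finset.range N) fun m _ => pt n m
  simp only [Finset.sum_add_distrib, ← Finset.mul_sum] at S
  -- evaluate the sums
  have SXY := sum_B1_B1 a C A B hC hA hB N (by rw [hN]; ring) x₁ x₂
  have Sdl := sum_dl_L a C A B hC hA hB N (by rw [hN]; ring) x₁ x₂
  have SXZ := sum_B1_B1 p (-B) (-A) (-C) (neg_ne_zero.mpr hB) (neg_ne_zero.mpr hA)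
    (neg_ne_zero.mpr hC) N (by rw [hN]; simp) x₁ x₂
  rw [show -B * -C = C * B by ring, show -A * -B = A * B by ring] at SXZ
  have tr1 : ∀ n m : ℤ, L x₁ x₂ a C (A * C) (a * n + b * m) (c * n + d * m)
      = L (d * x₁ - b * x₂) (-(c * x₁) + a * x₂) 1 0 (A * C) n m := by
    intro n m
    rw [L_trans _ _ _ _ _ _ _ _ _ h, ← eC]
    congr 1
    · linear_combination h
    · ring
  have tr2 : ∀ n m : ℤ, L x₁ x₂ p (-B) (A * B) (a * n + b * m) (c * n + d * m)
      = L (d * x₁ - b * x₂) (-(c * x₁) + a * x₂) a' A (A * B) n m := by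
    intro n m
    rw [L_trans _ _ _ _ _ _ _ _ _ h, ← eB, ← eA, hp]
    congr 1
    · linear_combination a' * h
    · linear_combination c' * h
  have SYZ := sum_B1_B1 a' A B C hA hB hC N (by rw [hN]; ring)
    (d * x₁ - b * x₂) (-(c * x₁) + a * x₂)
  have TYZ := box_SL2 N (fun n m => B1 (L x₁ x₂ a C (A * C) n m)
      * B1 (L x₁ x₂ p (-B) (A * B) n m)) (by
        intro n m i j
        rw [L_per B1 B1_add_int _ _ _ _ _ hAC N dAC, L_per B1 B1_add_int _ _ _ _ _ hAB N dAB])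
      a b c d h
  simp only [tr1, tr2] at TYZ
  rw [show B * A = A * B by ring] at SYZ
  rw [SYZ] at TYZ
  have SX2 := sum_B2_L (C * B) hCB N A.natAbs (by rw [hN, Int.natAbs_mul]; ring) x₁ x₂
  have SY2 := sum_B2_L (A * C) hAC N B.natAbs (by rw [hN, Int.natAbs_mul]; ring)
    (d * x₁ - b * x₂) (-(c * x₁) + a * x₂)
  have TY2 := box_SL2 N (fun n m => B2 (L x₁ x₂ a C (A * C) n m)) (by
        intro n m i j
        exact L_per B2 B2_add_int _ _ _ _ _ hAC N dAC _ _ _ _)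
      a b c d h
  simp only [tr1] at TY2
  rw [SY2] at TY2
  have h'' : p * (c * b' + d * d') - (a * b' + b * d') * (-B) = 1 := by
    rw [← eB, hp]
    linear_combination (a' * d' - b' * c') * h + h'
  have tr3 : ∀ n m : ℤ, L x₁ x₂ p (-B) (A * B)
        (p * n + (a * b' + b * d') * m) ((-B) * n + (c * b' + d * d') * m)
      = L (((c * b' + d * d' : ℤ) : ℝ) * x₁ - ((a * b' + b * d' : ℤ) : ℝ) * x₂)
          (-(((-B : ℤ) : ℝ) * x₁) + p * x₂) 1 0 (A * B) n m := by
    intro n m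
    have := L_trans x₁ x₂ p (-B) (A * B) p (a * b' + b * d') (-B) (c * b' + d * d') h'' n m
    rw [this]
    congr 1
    · linear_combination h''
    · ring
  have SZ2 := sum_B2_L (A * B) hAB N C.natAbs (by rw [hN, Int.natAbs_mul]; ring)
    (((c * b' + d * d' : ℤ) : ℝ) * x₁ - ((a * b' + b * d' : ℤ) : ℝ) * x₂)
          (-(((-B : ℤ) : ℝ) * x₁) + p * x₂)
  have TZ2 := box_SL2 N (fun n m => B2 (L x₁ x₂ p (-B) (A * B) n m)) (by
        intro n m i j
        exact L_per B2 B2_add_int _ _ _ _ _ hAB N dAB _ _ _ _)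
      p (a * b' + b * d') (-B) (c * b' + d * d') h''
  simp only [tr3] at TZ2
  rw [SZ2] at TZ2
  rw [SXY, TYZ, SXZ, SX2, TY2, TZ2, Sdl] at S
  rw [show -(((-B : ℤ) : ℝ) * x₁) + p * x₂ = B * x₁ + p * x₂ by push_cast; ring] at S
  simp only [Nat.cast_natAbs, Int.cast_abs, Int.cast_neg, Int.cast_mul, abs_mul, Real.sign_neg] at S
  generalize DR (-a) C x₁ x₂ = D1 at *
  generalize DR (-a') A (d * x₁ - b * x₂) (-(c * x₁) + a * x₂) = D2 at *
  generalize DR (-p) (-B) x₁ x₂ = D3 at *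
  generalize B2 x₂ = b1 at *
  generalize B2 (-(c * x₁) + a * x₂) = b2 at *
  generalize B2 (B * x₁ + p * x₂) = b3 at *
  generalize dl x₁ * dl x₂ = dd at *
  clear SXY Sdl SXZ SYZ TYZ SX2 SY2 TY2 SZ2 TZ2 tr1 tr2 tr3 pt
  have S' : -(Real.sign A * Real.sign B * D1) - Real.sign B * Real.sign C * D2
      - Real.sign A * Real.sign C * D3
      = -(1 / 2) * (|(A : ℝ)| * (1 / (|(C : ℝ)| * |(B : ℝ)|) * b1)
        + |(B : ℝ)| * (1 / (|(A : ℝ)| * |(C : ℝ)|) * b2)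
        + |(C : ℝ)| * (1 / (|(A : ℝ)| * |(B : ℝ)|) * b3)) + 1 / 4 * dd := by
    apply mul_left_cancel₀ hNR
    linear_combination S
  rcases sign_cases A hA with ⟨sA, aA⟩ | ⟨sA, aA⟩ <;>
  rcases sign_cases B hB with ⟨sB, aB⟩ | ⟨sB, aB⟩ <;>
  rcases sign_cases C hC with ⟨sC, aC⟩ | ⟨sC, aC⟩ <;>
  rw [sA, sB, sC, aA, aB, aC] at S' <;> rw [sA, sB, sC] <;> field_simp at S' ⊢ <;>
  linarith

lemma indZ_eq (q : ℚ) : indZ q = dl (q : ℝ) := by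
  unfold indZ dl
  congr 1
  rw [← exists_int_iff_fract, eq_iff_iff]
  constructor
  · intro h
    exact ⟨q.num, by exact_mod_cast (Rat.den_eq_one_iff q).mp h⟩
  · rintro ⟨n, hn⟩
    have : (n : ℚ) = q := by exact_mod_cast hn
    rw [← this]; simp

lemma dl_mul_eq (x y : ℝ) :
    dl x * dl y = if (∃ n m : ℤ, (n : ℝ) = x ∧ (m : ℝ) = y) then 1 else 0 := by
  simp only [dl, ← exists_int_iff_fract]
  by_cases h1 : ∃ n : ℤ, (n : ℝ) = x <;> by_cases h2 : ∃ n : ℤ, (n : ℝ) = y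
  · obtain ⟨n, hn⟩ := h1
    obtain ⟨m, hm⟩ := h2
    rw [if_pos ⟨n, hn⟩, if_pos ⟨m, hm⟩, if_pos ⟨n, m, hn, hm⟩, one_mul]
  all_goals
    rw [if_neg (c := ∃ n m : ℤ, (n : ℝ) = x ∧ (m : ℝ) = y)]
    · simp [h1, h2]
    · rintro ⟨n, m, hn, hm⟩
      first
        | exact h1 ⟨n, hn⟩
        | exact h2 ⟨m, hm⟩

lemma dl_mul_trans (a b c d : ℤ) (h : a * d - b * c = 1) (x₁ x₂ : ℝ) :
    dl (d * x₁ - b * x₂) * dl (-(c * x₁) + a * x₂) = dl x₁ * dl x₂ := by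
  have h1 : (a : ℝ) * d - b * c = 1 := by exact_mod_cast congrArg (Int.cast (R := ℝ)) h
  rw [dl_mul_eq, dl_mul_eq]
  congr 1
  rw [eq_iff_iff]
  constructor
  · rintro ⟨n, m, hn, hm⟩
    refine ⟨a * n + b * m, c * n + d * m, ?_, ?_⟩
    · push_cast; rw [hn, hm]; linear_combination x₁ * h1
    · push_cast; rw [hn, hm]; linear_combination x₂ * h1
  · rintro ⟨n, m, rfl, rfl⟩
    exact ⟨d * n - b * m, -(c * n) + a * m, by push_cast; ring, by push_cast; ring⟩

lemma sign_mul' (x y : ℝ) : Real.sign (x * y) = Real.sign x * Real.sign y := by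
  rcases lt_trichotomy x 0 with hx | rfl | hx <;> rcases lt_trichotomy y 0 with hy | rfl | hy
  all_goals try simp
  · rw [Real.sign_of_pos (mul_pos_of_neg_of_neg hx hy), Real.sign_of_neg hx, Real.sign_of_neg hy]
    norm_num
  · rw [Real.sign_of_neg (mul_neg_of_neg_of_pos hx hy), Real.sign_of_neg hx, Real.sign_of_pos hy]
    norm_num
  · rw [Real.sign_of_neg (mul_neg_of_pos_of_neg hx hy), Real.sign_of_pos hx, Real.sign_of_neg hy]
    norm_num
  · rw [Real.sign_of_pos (mul_pos hx hy), Real.sign_of_pos hx, Real.sign_of_pos hy]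
    norm_num

lemma sign_rel (A B C l m : ℝ) (hA : A ≠ 0) (hB : B ≠ 0) (hC : C ≠ 0) (hl : l ≠ 0) (hm : m ≠ 0)
    (h : A + B * l + C * m = 0) :
    Real.sign (C * l) + Real.sign (A * (m / l)) + Real.sign (B * m)
      = -(Real.sign A * Real.sign B * Real.sign C) := by
  rw [div_eq_mul_inv]
  simp only [sign_mul', Real.sign_inv]
  have hs : ∀ x : ℝ, x ≠ 0 → (x < 0 ∧ Real.sign x = -1) ∨ (0 < x ∧ Real.sign x = 1) := by
    intro x hx
    rcases lt_or_gt_of_ne hx with h | h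
    · exact Or.inl ⟨h, Real.sign_of_neg h⟩
    · exact Or.inr ⟨h, Real.sign_of_pos h⟩
  rcases hs A hA with ⟨pA, sA⟩ | ⟨pA, sA⟩ <;> rcases hs B hB with ⟨pB, sB⟩ | ⟨pB, sB⟩ <;>
  rcases hs C hC with ⟨pC, sC⟩ | ⟨pC, sC⟩ <;> rcases hs l hl with ⟨pl, sl⟩ | ⟨pl, sl⟩ <;>
  rcases hs m hm with ⟨pm, sm⟩ | ⟨pm, sm⟩ <;> rw [sA, sB, sC, sl, sm] <;>
  first
    | (norm_num; done)
    | (exfalso; nlinarith)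

lemma lin_ne (ω₁ ω₂ : ℝ) (hω : LinearIndependent ℚ ![ω₁, ω₂]) (p q : ℤ)
    (h : p ≠ 0 ∨ q ≠ 0) : (p : ℝ) * ω₁ + q * ω₂ ≠ 0 := by
  intro h0
  rw [LinearIndependent.pair_iff] at hω
  have := hω (p : ℚ) (q : ℚ) (by
    rw [Rat.smul_def, Rat.smul_def]; push_cast; exact h0)
  rcases h with h | h
  · exact h (by exact_mod_cast this.1)
  · exact h (by exact_mod_cast this.2)

/-- **Theorem (Statement 18).** The inhomogeneous 1-cocycle property of `𝔷₀` on
`SL₂(ℤ)` matrices with nonzero relevant lower-left entries. -/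
theorem statement18 (a b c d a' b' c' d' : ℤ)
    (h : a * d - b * c = 1) (h' : a' * d' - b' * c' = 1)
    (hc : c ≠ 0) (hc' : c' ≠ 0) (hcc : c * a' + d * c' ≠ 0)
    (x₁ x₂ : ℚ) (ω₁ ω₂ : ℝ) (hω : LinearIndependent ℚ ![ω₁, ω₂]) :
    Z0 (a * a' + b * c') (c * a' + d * c') x₁ x₂ ω₁ ω₂
      = Z0 a c x₁ x₂ ω₁ ω₂
        + Z0 a' c' ((d : ℚ) * x₁ - (b : ℚ) * x₂) (-((c : ℚ) * x₁) + (a : ℚ) * x₂)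
            ((a : ℝ) * ω₁ + (c : ℝ) * ω₂) ((b : ℝ) * ω₁ + (d : ℝ) * ω₂) := by
  have h1 : (a : ℝ) * d - b * c = 1 := by exact_mod_cast congrArg (Int.cast (R := ℝ)) h
  have g1 : Int.gcd a c = 1 := Int.isCoprime_iff_gcd_eq_one.mp ⟨d, -b, by linear_combination h⟩
  have g2 : Int.gcd a' c' = 1 :=
    Int.isCoprime_iff_gcd_eq_one.mp ⟨d', -b', by linear_combination h'⟩
  have g3 : Int.gcd (a * a' + b * c') (c * a' + d * c') = 1 :=
    Int.isCoprime_iff_gcd_eq_one.mp ⟨c * b' + d * d', -(a * b' + b * d'), by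
      linear_combination (a' * d' - b' * c') * h + h'⟩
  have hω1 : ω₁ ≠ 0 := by
    have := lin_ne ω₁ ω₂ hω 1 0 (Or.inl one_ne_zero)
    simpa using this
  have hl0 := lin_ne ω₁ ω₂ hω a c (Or.inr hc)
  have hm0 := lin_ne ω₁ ω₂ hω (a * a' + b * c') (c * a' + d * c') (Or.inr hcc)
  have core' := core a b c d a' b' c' d' h h' c' (-(c * a' + d * c')) c hc'
    (neg_ne_zero.mpr hcc) hc rfl (by ring) rfl (x₁ : ℝ) (x₂ : ℝ)
  rw [neg_neg] at core'
  have hdl := dl_mul_trans a b c d h (x₁ : ℝ) (x₂ : ℝ)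
  unfold Z0
  simp only [indZ_eq, g1, g2, g3]
  obtain ⟨p, hp⟩ : ∃ p : ℤ, p = a * a' + b * c' := ⟨_, rfl⟩
  obtain ⟨q, hq⟩ : ∃ q : ℤ, q = c * a' + d * c' := ⟨_, rfl⟩
  have hpR : (p : ℝ) = a * a' + b * c' := by rw [hp]; push_cast; ring
  have hqR : (q : ℝ) = c * a' + d * c' := by rw [hq]; push_cast; ring
  rw [← hp, ← hq] at core' hm0 ⊢
  rw [← hq] at hcc
  obtain ⟨l, hl⟩ : ∃ l : ℝ, l = a + c * (ω₂ / ω₁) := ⟨_, rfl⟩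
  obtain ⟨m, hm⟩ : ∃ m : ℝ, m = p + q * (ω₂ / ω₁) := ⟨_, rfl⟩
  have hlne : l ≠ 0 := by
    intro h0; apply hl0
    rw [h0] at hl; field_simp at hl; linarith
  have hmne : m ≠ 0 := by
    intro h0; apply hm0
    rw [h0] at hm; field_simp at hm; linarith
  have hml : (a' : ℝ) + c' * ((b * ω₁ + d * ω₂) / (a * ω₁ + c * ω₂)) = m / l := by
    rw [hl, hm, hpR, hqR]
    have : (a : ℝ) + c * (ω₂ / ω₁) = (a * ω₁ + c * ω₂) / ω₁ := by field_simp
    rw [this, div_div_eq_mul_div, eq_div_iff hl0, add_mul, mul_assoc, div_mul_cancel₀ _ hl0]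
    field_simp
    ring
  rw [hml, ← hl, ← hm]
  have hrel : (c' : ℝ) + (-q) * l + c * m = 0 := by
    rw [hl, hm, hpR, hqR]; linear_combination (-(c' : ℝ)) * h1
  have hcR : (c : ℝ) ≠ 0 := by exact_mod_cast hc
  have hcR' : (c' : ℝ) ≠ 0 := by exact_mod_cast hc'
  have hqne : (q : ℝ) ≠ 0 := by exact_mod_cast hcc
  have hsg := sign_rel c' (-q) c l m hcR' (neg_ne_zero.mpr hqne) hcR hlne hmne hrel
  push_cast at core' hsg ⊢
  rw [neg_mul, Real.sign_neg, Real.sign_neg] at hsg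
  rw [Real.sign_neg] at core'
  have e1 : B2 ((c : ℝ) / 1 * x₁ - a / 1 * x₂) = B2 (-(c * x₁) + a * x₂) := by
    rw [← B2_neg]; congr 1; ring
  have e2 : B2 ((q : ℝ) / 1 * x₁ - p / 1 * x₂) = B2 (-q * x₁ + p * x₂) := by
    rw [← B2_neg]; congr 1; ring
  have e3 : B2 ((c' : ℝ) / 1 * (d * x₁ - b * x₂) - a' / 1 * (-(c * x₁) + a * x₂))
      = B2 (-q * x₁ + p * x₂) := by
    rw [← B2_neg]; congr 1; rw [hpR, hqR]; ring
  rw [e1, e2, e3]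
  simp only [mul_assoc] at hdl ⊢
  rw [hdl]
  generalize DR (-a) c x₁ x₂ = D1 at *
  generalize DR (-a') c' (d * x₁ - b * x₂) (-(c * x₁) + a * x₂) = D2 at *
  generalize DR (-p) q x₁ x₂ = D3 at *
  generalize B2 (x₂ : ℝ) = b1 at *
  generalize B2 (-(c * (x₁ : ℝ)) + a * x₂) = b2 at *
  generalize B2 (-q * (x₁ : ℝ) + p * x₂) = b3 at *
  generalize dl (x₁ : ℝ) * dl (x₂ : ℝ) = dd at *
  have k1 : m / (2 * q) = l / (2 * c) + c' / (-q * c) / 2 := by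
    field_simp; linear_combination hrel
  have k2 : 0 = 1 / (2 * (c * l)) + m / l / (2 * c') + -q / (c' * c) / 2 := by
    field_simp; linear_combination (-1 : ℝ) * hrel
  have k3 : 1 / (2 * (q * m)) = 1 / (2 * (c' * (m / l))) + c / (c' * -q) / 2 := by
    field_simp; linear_combination hrel
  linear_combination b1 * k1 + b2 * k2 + b3 * k3 - core' + dd / 4 * hsg
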